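/- Let m, n ≥ 1 and 1 ≤ d ≤ m+1 be integers, let τ > 0, ν ≥ 0, and let P(z) = Σ_{k=0}^{d−1} a_k z^k be a real polynomial of degree at most d−1. Let D_r and D_s be datasets of size n over m+1 attributes such that ‖M_q(D_r) − M_q(D_s)‖₁ ≤ ν for every q ∈ Q^m_{≤d}. Then for every w ∈ ℝ^m with ‖w‖₂ ≤ τ: |(1/n)·Σ_{(x,y)∈D_r} P(⟨w,x⟩·y) − (1/n)·Σ_{(x,y)∈D_s} P(⟨w,x⟩·y)| ≤ (1/n)·(Σ_{k=0}^{d−1} |a_k|)·m^{d−1}·(max{1,τ})^{d−1}·ν. -/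

import Mathlib

noncomputable section
open Finset MeasureTheory ProbabilityTheory Real

def ValidDomains (m : ℕ) (Ω : Fin (m+1) → Finset ℝ) : Prop :=
  (∀ j, (Ω j : Set ℝ) ⊆ Set.Icc (-1 : ℝ) 1) ∧ Ω (Fin.last m) = ({-1, 1} : Finset ℝ)

def ValidDataset {m n : ℕ} (Ω : Fin (m+1) → Finset ℝ) (D : Fin n → Fin (m+1) → ℝ) : Prop :=
  ∀ i j, D i j ∈ Ω j

def marginal {m n : ℕ} (D : Fin n → Fin (m+1) → ℝ) (q : Finset (Fin (m+1)))
    (t : ∀ j ∈ q, ℝ) : ℝ :=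
  Nat.card {i : Fin n // ∀ j (h : j ∈ q), D i j = t j h}

def margL1 {m n : ℕ} (Ω : Fin (m+1) → Finset ℝ) (Dr Ds : Fin n → Fin (m+1) → ℝ)
    (q : Finset (Fin (m+1))) : ℝ :=
  ∑ t ∈ q.pi Ω, |marginal Dr q t - marginal Ds q t|

def margin {m : ℕ} (w : EuclideanSpace ℝ (Fin m)) (v : Fin (m+1) → ℝ) : ℝ :=
  (∑ j : Fin m, w j * v j.castSucc) * v (Fin.last m)

def risk {m n : ℕ} (φ : ℝ → ℝ) (w : EuclideanSpace ℝ (Fin m))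
    (D : Fin n → Fin (m+1) → ℝ) : ℝ :=
  (1 / n) * ∑ i, φ (margin w (D i))

lemma sum_comp_restrict_eq_sum_mul_marginal {m n : ℕ} (Ω : Fin (m+1) → Finset ℝ)
    (D : Fin n → Fin (m+1) → ℝ) (hD : ValidDataset Ω D) (q : Finset (Fin (m+1)))
    (F : (∀ j ∈ q, ℝ) → ℝ) :
    ∑ i, F (fun j _ => D i j) = ∑ t ∈ q.pi Ω, F t * marginal D q t := by
  classical
  have hmaps : ∀ i ∈ (Finset.univ : Finset (Fin n)),
      (fun (j : Fin (m+1)) (_ : j ∈ q) => D i j) ∈ q.pi Ω :=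
    fun i _ => Finset.mem_pi.2 fun j _ => hD i j
  rw [← Finset.sum_fiberwise_of_maps_to hmaps]
  refine Finset.sum_congr rfl fun t _ => ?_
  have hconst : ∀ i ∈ Finset.univ.filter
      (fun i => (fun (j : Fin (m+1)) (_ : j ∈ q) => D i j) = t),
      F (fun j _ => D i j) = F t := fun i hi => by
    rw [(Finset.mem_filter.1 hi).2]
  rw [Finset.sum_congr rfl hconst, Finset.sum_const, nsmul_eq_mul, mul_comm, marginal,
    Nat.card_eq_fintype_card, Fintype.card_subtype]
  simp only [funext_iff]

lemma abs_sum_sub_sum_le_margL1 {m n : ℕ} (Ω : Fin (m+1) → Finset ℝ)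
    (Dr Ds : Fin n → Fin (m+1) → ℝ) (hDr : ValidDataset Ω Dr) (hDs : ValidDataset Ω Ds)
    (q : Finset (Fin (m+1))) (F : (∀ j ∈ q, ℝ) → ℝ) (hF : ∀ t ∈ q.pi Ω, |F t| ≤ 1) :
    |∑ i, F (fun j _ => Dr i j) - ∑ i, F (fun j _ => Ds i j)| ≤ margL1 Ω Dr Ds q := by
  rw [sum_comp_restrict_eq_sum_mul_marginal Ω Dr hDr,
    sum_comp_restrict_eq_sum_mul_marginal Ω Ds hDs, ← Finset.sum_sub_distrib, margL1]
  refine (Finset.abs_sum_le_sum_abs _ _).trans (Finset.sum_le_sum fun t ht => ?_)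
  rw [← mul_sub, abs_mul]
  exact mul_le_of_le_one_left (abs_nonneg _) (hF t ht)

lemma margin_pow_eq_sum {m : ℕ} (w : EuclideanSpace ℝ (Fin m)) (v : Fin (m+1) → ℝ) (k : ℕ) :
    margin w v ^ k = ∑ p : Fin k → Fin m,
      (∏ l, w (p l)) * ∏ l, (v (p l).castSucc * v (Fin.last m)) := by
  simp_rw [margin, Finset.sum_mul, mul_assoc, Fintype.sum_pow, Finset.prod_mul_distrib]

lemma abs_sum_monomial_sub_le {m n k d : ℕ} (hk : k < d) {ν : ℝ}
    (Ω : Fin (m+1) → Finset ℝ) (hΩ : ValidDomains m Ω)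
    (Dr Ds : Fin n → Fin (m+1) → ℝ) (hDr : ValidDataset Ω Dr) (hDs : ValidDataset Ω Ds)
    (hmarg : ∀ q : Finset (Fin (m+1)), q.Nonempty → q.card ≤ d → margL1 Ω Dr Ds q ≤ ν)
    (p : Fin k → Fin m) :
    |∑ i, ∏ l, (Dr i (p l).castSucc * Dr i (Fin.last m)) -
      ∑ i, ∏ l, (Ds i (p l).castSucc * Ds i (Fin.last m))| ≤ ν := by
  classical
  let q : Finset (Fin (m+1)) :=
    insert (Fin.last m) (Finset.univ.image fun l => (p l).castSucc)
  have hlast : Fin.last m ∈ q := Finset.mem_insert_self _ _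
  have hp : ∀ l, (p l).castSucc ∈ q := fun l =>
    Finset.mem_insert_of_mem (Finset.mem_image_of_mem _ (Finset.mem_univ l))
  have hcard : q.card ≤ d := by
    have h₁ : q.card ≤ (Finset.univ.image fun l => (p l).castSucc).card + 1 :=
      Finset.card_insert_le _ _
    have h₂ : (Finset.univ.image fun l => (p l).castSucc).card ≤ k := by
      simpa using Finset.card_image_le (s := Finset.univ) (f := fun l => (p l).castSucc)
    omega
  refine (abs_sum_sub_sum_le_margL1 Ω Dr Ds hDr hDs q
    (fun t => ∏ l, (t (p l).castSucc (hp l) * t (Fin.last m) hlast)) fun t ht => ?_).trans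
    (hmarg q ⟨_, hlast⟩ hcard)
  have ht1 : ∀ j (hj : j ∈ q), |t j hj| ≤ 1 := fun j hj =>
    abs_le.2 (hΩ.1 j (Finset.mem_pi.1 ht j hj))
  rw [Finset.abs_prod]
  refine Finset.prod_le_one (fun _ _ => abs_nonneg _) fun l _ => ?_
  rw [abs_mul]
  exact mul_le_one₀ (ht1 _ _) (abs_nonneg _) (ht1 _ _)

lemma abs_sum_margin_pow_sub_le {m n k d : ℕ} (hm : 1 ≤ m) (hk : k < d) {τ ν : ℝ} (hν : 0 ≤ ν)
    (Ω : Fin (m+1) → Finset ℝ) (hΩ : ValidDomains m Ω)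
    (Dr Ds : Fin n → Fin (m+1) → ℝ) (hDr : ValidDataset Ω Dr) (hDs : ValidDataset Ω Ds)
    (hmarg : ∀ q : Finset (Fin (m+1)), q.Nonempty → q.card ≤ d → margL1 Ω Dr Ds q ≤ ν)
    (w : EuclideanSpace ℝ (Fin m)) (hw : ‖w‖ ≤ τ) :
    |∑ i, margin w (Dr i) ^ k - ∑ i, margin w (Ds i) ^ k| ≤
      (m : ℝ) ^ (d - 1) * (max 1 τ) ^ (d - 1) * ν := by
  have hsum : ∑ j, |w j| ≤ m * max 1 τ := by
    calc ∑ j, |w j| ≤ ∑ _j : Fin m, max 1 τ := Finset.sum_le_sum fun j _ =>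
          (PiLp.norm_apply_le w j).trans (hw.trans (le_max_right _ _))
      _ = m * max 1 τ := by simp
  have hbase : (1 : ℝ) ≤ m * max 1 τ :=
    one_le_mul_of_one_le_of_one_le (by exact_mod_cast hm) (le_max_left _ _)
  simp_rw [margin_pow_eq_sum]
  rw [Finset.sum_comm, Finset.sum_comm (s := Finset.univ (α := Fin n)),
    ← Finset.sum_sub_distrib]
  simp_rw [← Finset.mul_sum, ← mul_sub]
  calc _ ≤ ∑ p : Fin k → Fin m, (∏ l, |w (p l)|) * ν := by
        refine (Finset.abs_sum_le_sum_abs _ _).trans (Finset.sum_le_sum fun p _ => ?_)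
        rw [abs_mul, Finset.abs_prod]
        exact mul_le_mul_of_nonneg_left
          (abs_sum_monomial_sub_le hk Ω hΩ Dr Ds hDr hDs hmarg p)
          (Finset.prod_nonneg fun _ _ => abs_nonneg _)
    _ = (∑ j, |w j|) ^ k * ν := by rw [← Finset.sum_mul, Fintype.sum_pow]
    _ ≤ (m * max 1 τ) ^ (d - 1) * ν := by
        refine mul_le_mul_of_nonneg_right ?_ hν
        exact (pow_le_pow_left₀ (Finset.sum_nonneg fun _ _ => abs_nonneg _) hsum k).trans
          (pow_le_pow_right₀ hbase (by omega))
    _ = _ := by rw [mul_pow]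

/-- the difference of polynomial-approximated empirical risks on
two datasets with `ν`-close marginals of order at most `d`. -/
theorem poly_risk_diff_via_marginals
    (m n d : ℕ) (hm : 1 ≤ m) (hn : 1 ≤ n) (hd1 : 1 ≤ d) (hd2 : d ≤ m + 1)
    (τ ν : ℝ) (hτ : 0 < τ) (hν : 0 ≤ ν)
    (a : ℕ → ℝ)
    (Ω : Fin (m+1) → Finset ℝ) (hΩ : ValidDomains m Ω)
    (Dr Ds : Fin n → Fin (m+1) → ℝ) (hDr : ValidDataset Ω Dr) (hDs : ValidDataset Ω Ds)
    (hmarg : ∀ q : Finset (Fin (m+1)), q.Nonempty → q.card ≤ d → margL1 Ω Dr Ds q ≤ ν)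
    (w : EuclideanSpace ℝ (Fin m)) (hw : ‖w‖ ≤ τ) :
    |(1 / (n : ℝ)) * ∑ i : Fin n, (∑ k ∈ Finset.range d, a k * (margin w (Dr i)) ^ k) -
      (1 / (n : ℝ)) * ∑ i : Fin n, (∑ k ∈ Finset.range d, a k * (margin w (Ds i)) ^ k)| ≤
      (1 / (n : ℝ)) * (∑ k ∈ Finset.range d, |a k|) *
        (m : ℝ) ^ (d - 1) * (max 1 τ) ^ (d - 1) * ν := by
  rw [← mul_sub, abs_mul, abs_of_nonneg (by positivity : (0 : ℝ) ≤ 1 / n), mul_assoc, mul_assoc,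
    mul_assoc]
  refine mul_le_mul_of_nonneg_left ?_ (by positivity)
  rw [Finset.sum_comm, Finset.sum_comm (s := Finset.univ (α := Fin n)),
    ← Finset.sum_sub_distrib, Finset.sum_mul]
  refine (Finset.abs_sum_le_sum_abs _ _).trans (Finset.sum_le_sum fun k hk => ?_)
  rw [← Finset.mul_sum, ← Finset.mul_sum, ← mul_sub, abs_mul, ← mul_assoc (_ ^ _)]
  exact mul_le_mul_of_nonneg_left (abs_sum_margin_pow_sub_le hm (Finset.mem_range.1 hk) hν Ω hΩ
    Dr Ds hDr hDs hmarg w hw) (abs_nonneg _)
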